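/- Let T = (Q, Σ, δ) be an S-automaton and let 𝐩 ∈ Q⁺. The principal left ideal Q*𝐩∘ = {𝐪𝐩∘ ∣ 𝐪 ∈ Q*} of S(T) is infinite if and only if there is an ω-word ξ ∈ Σ^ω whose orbit Q*𝐩∘ξ = {𝐪𝐩∘ξ ∣ 𝐪 ∈ Q*, 𝐪𝐩∘ defined on ξ} under the action of the left ideal is infinite. -/

import Mathlib

/- Common framework for automaton semigroups acting on finite and infinite words.

An S-automaton over states `Q` and alphabet `A` is given by a partial deterministic
transition function `δ : Q → A → Option (A × Q)` (with `δ q a = some (b, p)` encoding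
the transition `q –a/b→ p`). -/

namespace AutOrbit

variable {Q A : Type*}

/-- The partial action `q∘` of a single state on a finite word. -/
def stateAct (δ : Q → A → Option (A × Q)) : Q → List A → Option (List A)
  | _, [] => some []
  | q, a :: u => (δ q a).bind fun bp => (stateAct δ bp.2 u).map fun v => bp.1 :: v

/-- The partial action `𝐪∘` of a state sequence `𝐪 = q_n … q_1` (written left-to-right,
head of the list is `q_n`; the rightmost state `q_1` is applied first). -/
def seqAct (δ : Q → A → Option (A × Q)) (l : List Q) (u : List A) : Option (List A) :=
  l.foldr (fun q acc => acc.bind (stateAct δ q)) (some u)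

/-- The length-`n` prefix of an ω-word. -/
def pre (ξ : ℕ → A) (n : ℕ) : List A := List.ofFn fun i : Fin n => ξ i

/-- The `L`-orbit `L∘u` of a finite word `u`. -/
def orbit (δ : Q → A → Option (A × Q)) (L : Set (List Q)) (u : List A) : Set (List A) :=
  {v | ∃ l ∈ L, seqAct δ l u = some v}

/-- The `L`-orbit `L∘ξ` of an ω-word `ξ`: all ω-words `η` such that some `𝐪 ∈ L` is
defined on `ξ` with `𝐪∘ξ = η` (i.e. `𝐪∘` maps every prefix of `ξ` to the
corresponding prefix of `η`). -/
def omegaOrbit (δ : Q → A → Option (A × Q)) (L : Set (List Q)) (ξ : ℕ → A) :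
    Set (ℕ → A) :=
  {η | ∃ l ∈ L, ∀ n, seqAct δ l (pre ξ n) = some (pre η n)}

/-- The set of partial maps `L∘ = {𝐪∘ ∣ 𝐪 ∈ L}`. -/
def mapsOf (δ : Q → A → Option (A × Q)) (L : Set (List Q)) :
    Set (List A → Option (List A)) :=
  {f | ∃ l ∈ L, f = seqAct δ l}

/-- `L ⊆ F*` is suffix-closed over `F`: every `𝐪 ∈ L` factorizes into factors from `F`
such that every suffix (as a word over the alphabet `F`) of the factorization is
again in `L`. -/
def SuffixClosedOver (F L : Set (List Q)) : Prop :=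
  ∀ l ∈ L, ∃ fs : List (List Q),
    (∀ f ∈ fs, f ∈ F) ∧ fs.flatten = l ∧ ∀ i, (fs.drop i).flatten ∈ L

/-- `L` is finitely suffix-closed: suffix-closed over some finite nonempty `F ⊆ Q*`. -/
def FinitelySuffixClosed (L : Set (List Q)) : Prop :=
  ∃ F : Set (List Q), F.Finite ∧ F.Nonempty ∧ SuffixClosedOver F L

/-- `u` has infinite potential w.r.t. `δ` and `L`: the orbit sizes `|L∘ux|` are unbounded. -/
def InfinitePotential (δ : Q → A → Option (A × Q)) (L : Set (List Q)) (u : List A) : Prop :=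
  ∀ C : ℕ, ∃ x : List A, C < (orbit δ L (u ++ x)).ncard

/-- The `i`-th power `𝐪^i` of a state sequence. -/
def listPow (l : List Q) (i : ℕ) : List Q := (List.replicate i l).flatten

/-- `𝐪∘` has torsion: two distinct positive powers induce the same partial map. -/
def HasTorsion (δ : Q → A → Option (A × Q)) (l : List Q) : Prop :=
  ∃ i j : ℕ, 1 ≤ i ∧ 1 ≤ j ∧ i ≠ j ∧ seqAct δ (listPow l i) = seqAct δ (listPow l j)

/-- The automaton is complete: `δ` is total. -/
def Complete (δ : Q → A → Option (A × Q)) : Prop := ∀ q a, (δ q a).isSome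

/-- The automaton is invertible: for every state, the letter-to-output-letter map is a
bijection of the alphabet (each output letter is produced by exactly one input letter). -/
def Invertible (δ : Q → A → Option (A × Q)) : Prop :=
  ∀ q b, ∃! a, ∃ p, δ q a = some (b, p)

/-- A G-automaton: a complete invertible S-automaton. -/
def GAutomaton (δ : Q → A → Option (A × Q)) : Prop := Complete δ ∧ Invertible δ

/-- Reversibility: for every input letter `a` and target state `p` there is at most one
transition `q –a/b→ p`. -/
def Reversible (δ : Q → A → Option (A × Q)) : Prop :=
  ∀ a p q₁ b₁ q₂ b₂, δ q₁ a = some (b₁, p) → δ q₂ a = some (b₂, p) → q₁ = q₂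

/-- Reversibility of the inverse automaton: for every output letter `b` and target
state `p` there is at most one transition `q –a/b→ p`. -/
def InvReversible (δ : Q → A → Option (A × Q)) : Prop :=
  ∀ b p q₁ a₁ q₂ a₂, δ q₁ a₁ = some (b, p) → δ q₂ a₂ = some (b, p) → q₁ = q₂ ∧ a₁ = a₂

/-- Bi-reversibility: the automaton and its inverse automaton are both reversible. -/
def BiReversible (δ : Q → A → Option (A × Q)) : Prop := Reversible δ ∧ InvReversible δ

/-- The dual automaton `∂T`: states are letters, letters are states; it has a transition
`a –q/p→ b` for every transition `q –a/b→ p` of `T`. -/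
def dual (δ : Q → A → Option (A × Q)) : A → Q → Option (Q × A) :=
  fun a q => (δ q a).map fun bp => (bp.2, bp.1)

/-- Adjacency of states in the underlying undirected graph of the automaton. -/
def Adj (δ : Q → A → Option (A × Q)) (q p : Q) : Prop :=
  (∃ a b, δ q a = some (b, p)) ∨ (∃ a b, δ p a = some (b, q))

/-- `P` is (the state set of) a connected component of the automaton. -/
def IsComponent (δ : Q → A → Option (A × Q)) (P : Set Q) : Prop :=
  ∃ q, P = {p | Relation.ReflTransGen (Adj δ) q p}

/-- The sub-automaton induced on `P` (with all transitions among states of `P`)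
is reversible. -/
def SubReversible (δ : Q → A → Option (A × Q)) (P : Set Q) : Prop :=
  ∀ a : A, ∀ p ∈ P, ∀ q₁ b₁ q₂ b₂, q₁ ∈ P → q₂ ∈ P →
    δ q₁ a = some (b₁, p) → δ q₂ a = some (b₂, p) → q₁ = q₂

/-- The inverse of the sub-automaton induced on `P` is reversible. -/
def SubInvReversible (δ : Q → A → Option (A × Q)) (P : Set Q) : Prop :=
  ∀ b : A, ∀ p ∈ P, ∀ q₁ a₁ q₂ a₂, q₁ ∈ P → q₂ ∈ P →
    δ q₁ a₁ = some (b, p) → δ q₂ a₂ = some (b, p) → q₁ = q₂ ∧ a₁ = a₂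

/-- The sub-automaton induced on `P` is bi-reversible. -/
def SubBiReversible (δ : Q → A → Option (A × Q)) (P : Set Q) : Prop :=
  SubReversible δ P ∧ SubInvReversible δ P

/-- For a complete automaton, the (total) action of a state on a finite word. -/
noncomputable def totAct (δ : Q → A → Option (A × Q)) (q : Q) (u : List A) : List A :=
  (stateAct δ q u).getD u

/-- The action of a state of the automaton (`Sum.inl`) or of its inverse automaton
(`Sum.inr`): for a G-automaton, `totAct δ q` is a bijection of `Σ*` and the inverse
state `q̄` acts as its inverse bijection. -/
noncomputable def gAct (δ : Q → A → Option (A × Q)) : Q ⊕ Q → List A → List A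
  | Sum.inl q => totAct δ q
  | Sum.inr q => Function.invFun (totAct δ q)

/-- Action of a sequence over `Q ⊔ Q̄` (rightmost entry applied first). -/
noncomputable def gSeqAct (δ : Q → A → Option (A × Q)) (l : List (Q ⊕ Q)) (u : List A) :
    List A :=
  l.foldr (fun s v => gAct δ s v) u

/-- The automaton group `G(T) = {𝐪∘ ∣ 𝐪 ∈ (Q ⊔ Q̄)⁺}` as a set of maps on `Σ*`. -/
def autGroup (δ : Q → A → Option (A × Q)) : Set (List A → List A) :=
  {f | ∃ l : List (Q ⊕ Q), l ≠ [] ∧ f = gSeqAct δ l}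

/-- The ultimately periodic ω-word `u (a v)^ω`. -/
def ultPer (u : List A) (a : A) (v : List A) (n : ℕ) : A :=
  if h : n < u.length then u.get ⟨n, h⟩
  else (a :: v).get ⟨(n - u.length) % (a :: v).length, Nat.mod_lt _ (by simp)⟩

/-- Run of a single state on a word, returning the output word and the final state. -/
def runState (δ : Q → A → Option (A × Q)) : Q → List A → Option (List A × Q)
  | q, [] => some ([], q)
  | q, a :: u => (δ q a).bind fun bp =>
      (runState δ bp.2 u).map fun vr => (bp.1 :: vr.1, vr.2)

/-- Run of a state sequence `𝐪` on a word `u`, returning the output word `𝐪∘u` and the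
residual state sequence `𝐪·u` (the dual action). -/
def runSeq (δ : Q → A → Option (A × Q)) : List Q → List A → Option (List A × List Q)
  | [], u => some (u, [])
  | q :: l, u => (runSeq δ l u).bind fun vr =>
      (runState δ q vr.1).map fun wp => (wp.1, wp.2 :: vr.2)

/-- Nodes of the `L`-orbital transducer over `F` of `u`: words reached from `u` along a
path of `F`-labeled edges whose reverse label (a word over `F`) lies in `L`. -/
def transNodes (δ : Q → A → Option (A × Q)) (F L : Set (List Q)) (u : List A) :
    Set (List A) :=
  {v | ∃ fs : List (List Q), (∀ f ∈ fs, f ∈ F) ∧ fs.flatten ∈ L ∧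
        ∃ r, runSeq δ fs.flatten u = some (v, r)}

/-- Edges of the `L`-orbital transducer over `F` of `u`: an edge `v –𝐩/𝐨→ w` with
`𝐩 ∈ F`, input label `𝐩`, output label `𝐨 = 𝐩·v`, lying on a path from `u` whose
reverse label is in `L`. -/
def transEdge (δ : Q → A → Option (A × Q)) (F L : Set (List Q)) (u : List A)
    (v : List A) (p o : List Q) (w : List A) : Prop :=
  p ∈ F ∧ ∃ fs : List (List Q), (∀ f ∈ fs, f ∈ F) ∧ (p :: fs).flatten ∈ L ∧
    (∃ r, runSeq δ fs.flatten u = some (v, r)) ∧ runSeq δ p v = some (w, o)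

/-- Isomorphism of the `L`-orbital transducers over `F` of `u₁` and `u₂`: a bijection of
the node sets mapping `u₁` to `u₂` and preserving labeled edges in both directions. -/
def TransducerIso (δ : Q → A → Option (A × Q)) (F L : Set (List Q)) (u₁ u₂ : List A) :
    Prop :=
  ∃ φ : List A → List A,
    Set.BijOn φ (transNodes δ F L u₁) (transNodes δ F L u₂) ∧ φ u₁ = u₂ ∧
    ∀ v ∈ transNodes δ F L u₁, ∀ w ∈ transNodes δ F L u₁, ∀ p o : List Q,
      (transEdge δ F L u₁ v p o w ↔ transEdge δ F L u₂ (φ v) p o (φ w))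

section

variable (δ : Q → A → Option (A × Q))

/-- The state sequences `𝐪𝐩` inducing the principal left ideal generated by `𝐩∘`. -/
abbrev leftIdealWords (p : List Q) : Set (List Q) := {l | ∃ q, l = q ++ p}

theorem stateAct_eq_map_runState (q : Q) (u : List A) :
    stateAct δ q u = (runState δ q u).map Prod.fst := by
  induction u generalizing q with
  | nil => rfl
  | cons a u ih =>
    cases h : δ q a with
    | none => simp [stateAct, runState, h]
    | some b => simp [stateAct, runState, h, ih, Function.comp_def]

theorem seqAct_cons (q : Q) (l : List Q) (u : List A) :
    seqAct δ (q :: l) u = (seqAct δ l u).bind (stateAct δ q) := rfl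

theorem seqAct_eq_map_runSeq (l : List Q) (u : List A) :
    seqAct δ l u = (runSeq δ l u).map Prod.fst := by
  induction l with
  | nil => rfl
  | cons q l ih =>
    rw [seqAct_cons, ih]
    cases h : runSeq δ l u with
    | none => simp [runSeq, h]
    | some b => simp [runSeq, h, stateAct_eq_map_runState, Function.comp_def]

theorem length_of_runState {q r : Q} {u w : List A} (h : runState δ q u = some (w, r)) :
    w.length = u.length := by
  induction u generalizing q w with
  | nil => simp_all [runState]
  | cons a u ih =>
    simp only [runState, Option.bind_eq_some_iff, Option.map_eq_some_iff, Prod.mk.injEq] at h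
    obtain ⟨b, -, ⟨v, s⟩, hv, rfl, rfl⟩ := h
    simp [ih hv]

theorem length_of_runSeq {l r : List Q} {u w : List A} (h : runSeq δ l u = some (w, r)) :
    w.length = u.length ∧ r.length = l.length := by
  induction l generalizing w r with
  | nil => simp_all [runSeq]
  | cons q l ih =>
    simp only [runSeq, Option.bind_eq_some_iff, Option.map_eq_some_iff, Prod.mk.injEq] at h
    obtain ⟨⟨v, s⟩, hv, ⟨x, t⟩, hx, rfl, rfl⟩ := h
    have := length_of_runState δ hx
    simp_all [ih hv]

theorem length_of_seqAct {l : List Q} {u w : List A} (h : seqAct δ l u = some w) :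
    w.length = u.length := by
  rw [seqAct_eq_map_runSeq, Option.map_eq_some_iff] at h
  obtain ⟨⟨v, r⟩, hv, rfl⟩ := h
  exact (length_of_runSeq δ hv).1

theorem stateAct_append (q : Q) (u x : List A) :
    stateAct δ q (u ++ x) =
      (runState δ q u).bind fun wr => (stateAct δ wr.2 x).map (wr.1 ++ ·) := by
  induction u generalizing q with
  | nil => simp [runState]
  | cons a u ih =>
    cases h : δ q a with
    | none => simp [stateAct, runState, h]
    | some b =>
      cases h' : runState δ b.2 u <;>
        simp [stateAct, runState, h, ih, h', Function.comp_def]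

theorem seqAct_append (l : List Q) (u x : List A) :
    seqAct δ l (u ++ x) =
      (runSeq δ l u).bind fun wr => (seqAct δ wr.2 x).map (wr.1 ++ ·) := by
  induction l with
  | nil => simp [seqAct, runSeq]
  | cons q l ih =>
    rw [seqAct_cons, ih]
    cases h : runSeq δ l u with
    | none => simp [runSeq, h]
    | some b =>
      cases h' : runState δ q b.1 with
      | none =>
        cases h'' : seqAct δ b.2 x <;> simp [runSeq, h, h', h'', stateAct_append]
      | some c =>
        cases h'' : seqAct δ b.2 x <;>
          simp [runSeq, h, h', h'', stateAct_append, seqAct_cons]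

theorem seqAct_prefix {l : List Q} {u x z : List A} (h : seqAct δ l (u ++ x) = some z) :
    ∃ w, seqAct δ l u = some w ∧ w <+: z := by
  rw [seqAct_append, Option.bind_eq_some_iff] at h
  obtain ⟨⟨w, r⟩, hw, h⟩ := h
  rw [Option.map_eq_some_iff] at h
  obtain ⟨y, -, rfl⟩ := h
  exact ⟨w, by simp [seqAct_eq_map_runSeq, hw], List.prefix_append _ _⟩

theorem seqAct_nil (l : List Q) : seqAct δ l ([] : List A) = some [] := by
  induction l with
  | nil => rfl
  | cons q l ih => simp [seqAct_cons, ih, stateAct]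

theorem orbit_finite [Finite A] (L : Set (List Q)) (u : List A) : (orbit δ L u).Finite := by
  refine (List.finite_length_eq A u.length).subset ?_
  rintro v ⟨l, -, h⟩
  exact length_of_seqAct δ h

/-- A partial transducer with states `Fin (C + 1)` reading and writing letters of `Q`, along with
an optional initial configuration, whose output has length `n`. -/
abbrev OrbitMachine (Q : Type*) (C n : ℕ) :=
  (Fin (C + 1) → Q → Option (Fin (C + 1) × Q)) ×
    Option (Fin (C + 1) × {r : List Q // r.length = n})

namespace OrbitMachine

variable {C n : ℕ}

/-- The configuration of the machine after reading a state sequence from right to left. -/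
def run (k : OrbitMachine Q C n) : List Q → Option (Fin (C + 1) × List Q)
  | [] => k.2.map fun s => (s.1, s.2.1)
  | q :: l => (run k l).bind fun s => (k.1 s.1 q).map fun t => (t.1, t.2 :: s.2)

/-- The number of words `ux` is mapped to by the orbit, if `u` is described by the machine. -/
noncomputable def size (k : OrbitMachine Q C n) (x : List A) : ℕ :=
  {s : Fin (C + 1) × List A |
    ∃ l r, k.run l = some (s.1, r) ∧ seqAct δ r x = some s.2}.ncard

end OrbitMachine

/-- The `Q*𝐩`-orbit of a word is described by a machine if it has at most `C` elements. -/
theorem exists_orbitMachine [Finite A] (p : List Q) {C : ℕ} {u : List A}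
    (hu : (orbit δ (leftIdealWords p) u).ncard ≤ C) :
    ∃ k : OrbitMachine Q C p.length,
      (∀ q, (runSeq δ (q ++ p) u).map Prod.snd = (k.run q).map Prod.snd) ∧
      ∀ x, (orbit δ (leftIdealWords p) (u ++ x)).ncard = k.size δ x := by
  classical
  have hfin := orbit_finite δ (leftIdealWords p) u
  obtain ⟨φ, -, hφ⟩ := hfin.exists_injOn_of_encard_le (t := (Set.univ : Set (Fin (C + 1)))) (by
    rw [← hfin.cast_ncard_eq, Set.encard_univ]
    simp only [ENat.card_eq_coe_fintype_card, Fintype.card_fin]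
    exact_mod_cast hu.trans C.le_succ)
  have hmem : ∀ {q w r}, runSeq δ (q ++ p) u = some (w, r) →
      w ∈ orbit δ (leftIdealWords p) u := fun {q w r} h =>
    ⟨q ++ p, ⟨q, rfl⟩, by simp [seqAct_eq_map_runSeq, h]⟩
  let k : OrbitMachine Q C p.length :=
    (fun i q => (runState δ q (Function.invFunOn φ (orbit δ (leftIdealWords p) u) i)).map
        (Prod.map φ id),
      (runSeq δ p u).pmap (fun s hs => (φ s.1, ⟨s.2, hs⟩))
        fun s hs => (length_of_runSeq δ hs).2)
  have hrun : ∀ q, k.run q = (runSeq δ (q ++ p) u).map (Prod.map φ id) := by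
    intro q
    induction q with
    | nil =>
      cases h : runSeq δ p u <;> simp [k, OrbitMachine.run, h, Prod.map]
    | cons q l ih =>
      cases h : runSeq δ (l ++ p) u with
      | none => simp [OrbitMachine.run, ih, h, runSeq]
      | some s =>
        have hs := hφ.leftInvOn_invFunOn (hmem h)
        simp [OrbitMachine.run, ih, h, runSeq, k, hs, Function.comp_def]
  refine ⟨k, fun q => by simp [hrun, Function.comp_def], fun x => ?_⟩
  rw [OrbitMachine.size]
  have hsplit : ∀ {z}, z ∈ orbit δ (leftIdealWords p) (u ++ x) ↔
      ∃ q w r y, runSeq δ (q ++ p) u = some (w, r) ∧ seqAct δ r x = some y ∧ z = w ++ y := by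
    intro z
    constructor
    · rintro ⟨_, ⟨q, rfl⟩, h⟩
      rw [seqAct_append, Option.bind_eq_some_iff] at h
      obtain ⟨⟨w, r⟩, hw, h⟩ := h
      rw [Option.map_eq_some_iff] at h
      obtain ⟨y, hy, rfl⟩ := h
      exact ⟨q, w, r, y, hw, hy, rfl⟩
    · rintro ⟨q, w, r, y, hw, hy, rfl⟩
      exact ⟨q ++ p, ⟨q, rfl⟩, by simp [seqAct_append, hw, hy]⟩
  rw [← Set.InjOn.ncard_image
    (f := fun z : List A => (φ (z.take u.length), z.drop u.length))]
  · congr 1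
    ext ⟨i, y⟩
    simp only [Set.mem_image, hsplit, Set.mem_ofPred_eq, hrun]
    constructor
    · rintro ⟨_, ⟨q, w, r, y', hw, hy, rfl⟩, h⟩
      have hl := (length_of_runSeq δ hw).1
      rw [← hl, List.take_left, List.drop_left, Prod.mk.injEq] at h
      obtain ⟨rfl, rfl⟩ := h
      exact ⟨q, r, by simp [hw], hy⟩
    · rintro ⟨q, r, h, hy⟩
      rw [Option.map_eq_some_iff] at h
      obtain ⟨⟨w, r'⟩, hw, h⟩ := h
      obtain ⟨rfl, rfl⟩ := Prod.mk.inj h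
      refine ⟨w ++ y, ⟨q, w, r', y, hw, hy, rfl⟩, ?_⟩
      rw [← (length_of_runSeq δ hw).1, List.take_left, List.drop_left]
  · intro z hz z' hz' h
    obtain ⟨q, w, r, y, hw, hy, rfl⟩ := hsplit.1 hz
    obtain ⟨q', w', r', y', hw', hy', rfl⟩ := hsplit.1 hz'
    have hl := (length_of_runSeq δ hw).1
    have hl' := (length_of_runSeq δ hw').1
    simp only [Prod.mk.injEq] at h
    rw [List.take_left' hl, List.drop_left' hl, List.take_left' hl', List.drop_left' hl'] at h
    rw [hφ (hmem hw) (hmem hw') h.1, h.2]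

instance (C n : ℕ) [Finite Q] : Finite (OrbitMachine Q C n) := by
  have : Finite {r : List Q // r.length = n} := List.finite_length_eq Q n
  unfold OrbitMachine
  infer_instance

/-- If all orbits of finite words are bounded, the left ideal is finite. -/
theorem mapsOf_finite_of_bounded [Finite Q] [Finite A] (p : List Q) (C : ℕ)
    (h : ∀ u, (orbit δ (leftIdealWords p) u).ncard ≤ C) :
    (mapsOf δ (leftIdealWords p)).Finite := by
  choose k hk _ using fun u => exists_orbitMachine δ p (h u)
  let code : List Q → OrbitMachine Q C p.length → A → Option A := fun q k a =>
    ((k.run q).map Prod.snd).bind fun r => (seqAct δ r [a]).bind List.head?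
  have hcode : (fun q => seqAct δ (q ++ p)).FactorsThrough code := by
    intro q q' hq
    funext u
    induction u using List.reverseRecOn with
    | nil => simp [seqAct_nil]
    | append_singleton u a ih =>
      have hq := congrFun (congrFun hq (k u)) a
      simp only [code, ← hk] at hq
      simp only [seqAct_eq_map_runSeq δ _ u] at ih
      change seqAct δ (q ++ p) (u ++ [a]) = seqAct δ (q' ++ p) (u ++ [a])
      rw [seqAct_append, seqAct_append]
      rcases h₁ : runSeq δ (q ++ p) u with _ | ⟨w, r⟩ <;>
        rcases h₂ : runSeq δ (q' ++ p) u with _ | ⟨w', r'⟩ <;>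
        simp only [h₁, h₂, Option.map_none, Option.map_some, reduceCtorEq, Option.some.injEq] at ih
      · rfl
      · subst ih
        simp only [h₁, h₂, Option.map_some, Option.bind_some] at hq ⊢
        congr 1
        rcases h₃ : seqAct δ r [a] with _ | z <;> rcases h₄ : seqAct δ r' [a] with _ | z' <;>
          simp only [h₃, h₄, Option.bind_none, Option.bind_some] at hq ⊢
        · have := length_of_seqAct δ h₄
          cases z' <;> simp_all
        · have := length_of_seqAct δ h₃
          cases z <;> simp_all
        · obtain ⟨b, rfl⟩ := List.length_eq_one_iff.1 (length_of_seqAct δ h₃)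
          obtain ⟨b', rfl⟩ := List.length_eq_one_iff.1 (length_of_seqAct δ h₄)
          simp_all
  refine (Set.finite_range (Function.extend code (fun q => seqAct δ (q ++ p))
    fun _ => seqAct δ p)).subset ?_
  rintro _ ⟨_, ⟨q, rfl⟩, rfl⟩
  exact ⟨code q, hcode.extend_apply _ _⟩

/-- A word of infinite potential has extensions of infinite potential with arbitrarily large
orbits. -/
theorem InfinitePotential.exists_append [Finite Q] [Finite A] {p : List Q} {u : List A}
    (hu : InfinitePotential δ (leftIdealWords p) u) (C : ℕ) :
    ∃ x, InfinitePotential δ (leftIdealWords p) (u ++ x) ∧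
      C < (orbit δ (leftIdealWords p) (u ++ x)).ncard := by
  by_contra! hC
  have hM : ∃ M, ∀ s : OrbitMachine Q C p.length × A,
      (∃ B, ∀ x, s.1.size δ (s.2 :: x) ≤ B) → ∀ x, s.1.size δ (s.2 :: x) ≤ M := by
    have : ∀ s : OrbitMachine Q C p.length × A, ∃ B,
        (∃ B, ∀ x, s.1.size δ (s.2 :: x) ≤ B) → ∀ x, s.1.size δ (s.2 :: x) ≤ B := by
      intro s
      by_cases h : ∃ B, ∀ x, s.1.size δ (s.2 :: x) ≤ B
      · exact h.imp fun B hB _ => hB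
      · exact ⟨0, fun h' => absurd h' h⟩
    choose B hB using this
    obtain ⟨M, hM⟩ := (Set.finite_range B).bddAbove
    exact ⟨M, fun s hs x => (hB s hs x).trans (hM ⟨s, rfl⟩)⟩
  obtain ⟨M, hM⟩ := hM
  have key : ∀ y x, InfinitePotential δ (leftIdealWords p) (u ++ x) →
      (orbit δ (leftIdealWords p) (u ++ x ++ y)).ncard ≤ max C M := by
    intro y
    induction y with
    | nil => exact fun x hx => by simpa using Or.inl (hC x hx)
    | cons a y ih =>
      intro x hx
      by_cases hxa : InfinitePotential δ (leftIdealWords p) (u ++ (x ++ [a]))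
      · simpa using ih (x ++ [a]) hxa
      · obtain ⟨k, -, hk⟩ := exists_orbitMachine δ p (hC x hx)
        rw [hk]
        refine (hM (k, a) ?_ y).trans (le_max_right _ _)
        unfold InfinitePotential at hxa
        push Not at hxa
        obtain ⟨B, hB⟩ := hxa
        refine ⟨B, fun z => ?_⟩
        have := hB z
        simp only [List.append_assoc, List.singleton_append] at this
        rwa [← List.append_assoc, hk] at this
  obtain ⟨y, hy⟩ := hu (max C M)
  have := key y [] (by simpa using hu)
  simp only [List.append_nil] at this
  omega

/-- A sequence of words that is increasing with respect to the prefix order and unbounded in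
length converges to an ω-word. -/
theorem exists_eq_pre (w : ℕ → List A) (hw : ∀ n, w n <+: w (n + 1))
    (hlen : ∀ n, n ≤ (w n).length) : ∃ η : ℕ → A, ∀ n, w n = pre η (w n).length := by
  have hmono : ∀ {m n}, m ≤ n → w m <+: w n := fun {m n} h => by
    induction h with
    | refl => exact List.prefix_rfl
    | step _ ih => exact ih.trans (hw _)
  refine ⟨fun n => (w (n + 1))[n]'(hlen (n + 1)), fun n => ?_⟩
  refine List.ext_getElem (by simp [pre]) fun i hi _ => ?_
  simp only [pre, List.getElem_ofFn]
  rcases le_total n (i + 1) with h | h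
  · exact (hmono h).getElem hi
  · exact ((hmono h).getElem (hlen (i + 1))).symm

theorem pre_prefix (ξ : ℕ → A) {m n : ℕ} (h : m ≤ n) : pre ξ m <+: pre ξ n := by
  rw [List.prefix_iff_getElem]
  exact ⟨by simpa [pre] using h, fun i hi => by simp [pre]⟩

/-- A state sequence defined on all prefixes of an ω-word is defined on the ω-word. -/
theorem exists_omega_image (l : List Q) (ξ : ℕ → A)
    (h : ∀ n, ∃ w, seqAct δ l (pre ξ n) = some w) :
    ∃ η : ℕ → A, ∀ n, seqAct δ l (pre ξ n) = some (pre η n) := by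
  choose w hw using h
  have hlen : ∀ n, (w n).length = n := fun n => by simpa [pre] using length_of_seqAct δ (hw n)
  obtain ⟨η, hη⟩ := exists_eq_pre w (fun n => by
    obtain ⟨x, hx⟩ := pre_prefix ξ n.le_succ
    obtain ⟨v, hv, hpre⟩ := seqAct_prefix δ (hx ▸ hw (n + 1))
    rw [hw n, Option.some.injEq] at hv
    exact hv ▸ hpre) fun n => (hlen n).ge
  refine ⟨η, fun n => ?_⟩
  rw [hw, hη n, hlen]

open Filter in
/-- For large `n`, a state sequence is undefined on the prefix of length `n` unless it is
defined on the whole ω-word. -/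
theorem eventually_seqAct_eq_pre (l : List Q) (ξ : ℕ → A) :
    ∀ᶠ n in atTop, ∀ w, seqAct δ l (pre ξ n) = some w →
      ∃ η : ℕ → A, (∀ m, seqAct δ l (pre ξ m) = some (pre η m)) ∧ w = pre η n := by
  by_cases h : ∀ n, ∃ w, seqAct δ l (pre ξ n) = some w
  · obtain ⟨η, hη⟩ := exists_omega_image δ l ξ h
    refine Eventually.of_forall fun n w hw => ⟨η, hη, ?_⟩
    rwa [hη, Option.some.injEq, eq_comm] at hw
  · push Not at h
    obtain ⟨N, hN⟩ := h
    filter_upwards [eventually_ge_atTop N] with n hn w hw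
    obtain ⟨x, hx⟩ := pre_prefix ξ hn
    obtain ⟨v, hv, -⟩ := seqAct_prefix δ (hx ▸ hw)
    exact absurd hv (hN v)

open Filter in
/-- If the orbit of an ω-word is finite, the orbits of its prefixes are bounded. -/
theorem bounded_orbit_pre [Finite Q] [Finite A] (p : List Q) (ξ : ℕ → A)
    (h : (omegaOrbit δ (leftIdealWords p) ξ).Finite) :
    ∃ B, ∀ n, (orbit δ (leftIdealWords p) (pre ξ n)).ncard ≤ B := by
  have hstep : ∀ᶠ n in atTop, ∀ η ∈ omegaOrbit δ (leftIdealWords p) ξ, ∀ q : Q, ∀ w,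
      seqAct δ [q] (pre η n) = some w →
      ∃ η' : ℕ → A, (∀ m, seqAct δ [q] (pre η m) = some (pre η' m)) ∧ w = pre η' n :=
    (eventually_all_finite h).2 fun η _ => eventually_all.2 fun q =>
      eventually_seqAct_eq_pre δ [q] η
  have hev : ∀ᶠ n in atTop, (orbit δ (leftIdealWords p) (pre ξ n)).ncard ≤
      (omegaOrbit δ (leftIdealWords p) ξ).ncard := by
    filter_upwards [hstep, eventually_seqAct_eq_pre δ p ξ] with n hn hp
    refine (Set.ncard_le_ncard ?_ (h.image fun η => pre η n)).trans (Set.ncard_image_le h)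
    rintro w ⟨_, ⟨q, rfl⟩, hw⟩
    induction q generalizing w with
    | nil =>
      obtain ⟨η, hη, rfl⟩ := hp w hw
      exact ⟨η, ⟨p, ⟨[], rfl⟩, hη⟩, rfl⟩
    | cons q l ih =>
      rw [List.cons_append, seqAct_cons, Option.bind_eq_some_iff] at hw
      obtain ⟨v, hv, hw⟩ := hw
      obtain ⟨η, hη, rfl⟩ := ih hv
      obtain ⟨η', hη', rfl⟩ := hn η hη q w hw
      obtain ⟨_, ⟨l', rfl⟩, hl'⟩ := hη
      refine ⟨η', ⟨q :: l' ++ p, ⟨q :: l', rfl⟩, fun m => ?_⟩, rfl⟩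
      rw [List.cons_append, seqAct_cons, hl']
      exact hη' m
  obtain ⟨B, hB⟩ := (isBoundedUnder_of_eventually_le hev).bddAbove_range
  exact ⟨B, fun n => hB ⟨n, rfl⟩⟩

/-- A word of infinite potential extends to an ω-word with prefixes of arbitrarily large
orbits. -/
theorem InfinitePotential.exists_omega [Finite Q] [Finite A] {p : List Q}
    (h : InfinitePotential δ (leftIdealWords p) ([] : List A)) :
    ∃ ξ : ℕ → A, ∀ B, ∃ n, B < (orbit δ (leftIdealWords p) (pre ξ n)).ncard := by
  choose x hx hlarge using fun (u : {u // InfinitePotential δ (leftIdealWords p) u}) C =>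
    u.2.exists_append δ C
  let w : ℕ → {u : List A // InfinitePotential δ (leftIdealWords p) u} := fun n =>
    Nat.rec ⟨[], h⟩ (fun n u =>
      ⟨_, hx u (max n (orbit δ (leftIdealWords p) u.1).ncard)⟩) n
  have hw : ∀ n, (w (n + 1)).1 =
      (w n).1 ++ x (w n) (max n (orbit δ (leftIdealWords p) (w n).1).ncard) := fun _ => rfl
  have hsize : ∀ n, max n (orbit δ (leftIdealWords p) (w n).1).ncard <
      (orbit δ (leftIdealWords p) (w (n + 1)).1).ncard := fun n => by
    rw [hw]
    exact hlarge _ _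
  have hpre : ∀ n, (w n).1 <+: (w (n + 1)).1 := fun n => hw n ▸ List.prefix_append _ _
  obtain ⟨ξ, hξ⟩ := exists_eq_pre (fun n => (w n).1) hpre fun n => by
    induction n with
    | zero => exact Nat.zero_le _
    | succ n ih =>
      refine ih.trans_lt ((hpre n).length_le.lt_of_ne fun heq => ?_)
      have := hsize n
      rw [(hpre n).eq_of_length heq] at this
      omega
  refine ⟨ξ, fun B => ⟨(w (B + 1)).1.length, ?_⟩⟩
  rw [← hξ (B + 1)]
  exact (le_max_left _ _).trans_lt (hsize B)

theorem pre_injective : Function.Injective (pre : (ℕ → A) → ℕ → List A) := by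
  intro ξ η h
  funext n
  simpa [pre, -List.ofFn_succ] using congrArg (·[n]?) (congrFun h (n + 1))

/-- A finite set of maps has only finite orbits of ω-words. -/
theorem omegaOrbit_finite (L : Set (List Q)) (h : (mapsOf δ L).Finite) (ξ : ℕ → A) :
    (omegaOrbit δ L ξ).Finite := by
  refine Set.Finite.of_finite_image ((h.image fun f n => f (pre ξ n)).subset ?_)
    (f := fun η n => some (pre η n)) fun η _ η' _ heq => pre_injective ?_
  · rintro _ ⟨η, ⟨l, hl, hη⟩, rfl⟩
    exact ⟨_, ⟨l, hl, rfl⟩, funext hη⟩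
  · exact funext fun n => Option.some.inj (congrFun heq n)

end

/-- For `𝐩 ∈ Q⁺`, the principal left ideal `Q*𝐩∘` of `S(T)` is infinite
iff there is an ω-word `ξ` whose orbit `Q*𝐩∘ξ` is infinite. -/
theorem leftIdeal_infinite_iff_omegaOrbit_infinite {Q A : Type*} [Fintype Q] [Fintype A]
    [Nonempty A] (δ : Q → A → Option (A × Q)) (p : List Q) (hp : p ≠ []) :
    (mapsOf δ {l : List Q | ∃ q : List Q, l = q ++ p}).Infinite ↔
      ∃ ξ : ℕ → A, (omegaOrbit δ {l : List Q | ∃ q : List Q, l = q ++ p} ξ).Infinite := by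
  constructor
  · intro h
    have hpot : InfinitePotential δ (leftIdealWords p) [] := by
      by_contra hb
      unfold InfinitePotential at hb
      push Not at hb
      obtain ⟨C, hC⟩ := hb
      exact h (mapsOf_finite_of_bounded δ p C hC)
    obtain ⟨ξ, hξ⟩ := hpot.exists_omega
    refine ⟨ξ, fun hfin => ?_⟩
    obtain ⟨B, hB⟩ := bounded_orbit_pre δ p ξ hfin
    obtain ⟨n, hn⟩ := hξ B
    exact (hB n).not_gt hn
  · rintro ⟨ξ, hξ⟩ hfin
    exact hξ (omegaOrbit_finite δ _ hfin ξ)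

end AutOrbit
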